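/- For g ≥ 4, the linear map 𝔞_g(2) → Λ²H/ℚω̄₀ sending D to π(C₁₃(D*)) is surjective and its kernel equals the linear span of {[D₁,D₂] : D₁, D₂ ∈ 𝔞_g(1)}; consequently it induces a linear isomorphism H₁(𝔞_g⁺)₂ := 𝔞_g(2)/span{[D₁,D₂] : D₁,D₂ ∈ 𝔞_g(1)} ≅ Λ²H/ℚω̄₀. -/

import Mathlib

set_option maxSynthPendingDepth 2

/- Coordinate model of the symplectic vector space `H = ℚ^{2g}` and its tensor powers.
`I g` indexes the symplectic basis `x_1, …, x_g, y_1, …, y_g`;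
`T g m` is the coordinate model of `H^{⊗ m}` (coordinates w.r.t. the basis tensors). -/

abbrev I (g : ℕ) := Fin g ⊕ Fin g
abbrev H (g : ℕ) := I g → ℚ
abbrev T (g m : ℕ) := (Fin m → I g) → ℚ

/-- the basis vector `x_i` -/
def xB (g : ℕ) (i : Fin g) : H g := Pi.single (Sum.inl i) 1
/-- the basis vector `y_i` -/
def yB (g : ℕ) (i : Fin g) : H g := Pi.single (Sum.inr i) 1

/-- the symplectic intersection pairing `u · v` -/
def pairH (g : ℕ) (u v : H g) : ℚ :=
  ∑ i : Fin g, (u (Sum.inl i) * v (Sum.inr i) - u (Sum.inr i) * v (Sum.inl i))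

/-- `D(ω₀) = (D ⊗ id + id ⊗ D)(ω₀)` for `ω₀ = Σᵢ (xᵢ ⊗ yᵢ - yᵢ ⊗ xᵢ)`. -/
def Dom (g k : ℕ) (D : H g →ₗ[ℚ] T g (k+1)) : T g (k+2) := fun φ =>
  ∑ i : Fin g,
    (D (xB g i) (fun p => φ p.castSucc) * yB g i (φ (Fin.last (k+1)))
      + xB g i (φ 0) * D (yB g i) (fun p => φ p.succ)
      - D (yB g i) (fun p => φ p.castSucc) * xB g i (φ (Fin.last (k+1)))
      - yB g i (φ 0) * D (xB g i) (fun p => φ p.succ))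

/-- `D* = Σᵢ (xᵢ ⊗ D(yᵢ) - yᵢ ⊗ D(xᵢ))`. -/
def dstar (g k : ℕ) (D : H g →ₗ[ℚ] T g (k+1)) : T g (k+2) := fun φ =>
  ∑ i : Fin g,
    (xB g i (φ 0) * D (yB g i) (fun p => φ p.succ)
      - yB g i (φ 0) * D (xB g i) (fun p => φ p.succ))

/-- the cyclic permutation `σ_m : u₁ ⊗ ⋯ ⊗ u_m ↦ u₂ ⊗ ⋯ ⊗ u_m ⊗ u₁`. -/
def cyc (g m : ℕ) (t : T g m) : T g m := fun φ => t (φ ∘ (finRotate m).symm)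

/-- The unique extension of `D : H → H^{⊗(k+1)}` to a derivation of the tensor algebra,
restricted to a map `H^{⊗m} → H^{⊗(m+k)}` (in coordinates): on decomposables it is
`u₁⊗⋯⊗u_m ↦ Σ_p u₁⊗⋯⊗D(u_p)⊗⋯⊗u_m`. -/
def ext (g k m : ℕ) (D : H g →ₗ[ℚ] T g (k+1)) : T g m →ₗ[ℚ] T g (m+k) where
  toFun t := fun ψ =>
    ∑ p : Fin m, ∑ c : I g,
      D (Pi.single c 1) (fun r : Fin (k+1) => ψ ⟨p.1 + r.1, by have := p.2; have := r.2; omega⟩)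
        * t (fun q : Fin m =>
            if q.1 < p.1 then ψ ⟨q.1, by have := q.2; omega⟩
            else if q = p then c
            else ψ ⟨q.1 + k, by have := q.2; omega⟩)
  map_add' t t' := by
    funext ψ
    simp only [Pi.add_apply]
    rw [← Finset.sum_add_distrib]
    refine Finset.sum_congr rfl fun p _ => ?_
    rw [← Finset.sum_add_distrib]
    refine Finset.sum_congr rfl fun c _ => ?_
    ring
  map_smul' a t := by
    funext ψ
    simp only [Pi.smul_apply, smul_eq_mul, RingHom.id_apply]
    rw [Finset.mul_sum]
    refine Finset.sum_congr rfl fun p _ => ?_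
    rw [Finset.mul_sum]
    refine Finset.sum_congr rfl fun c _ => ?_
    ring

/-- The bracket `[D₁, D₂]` of two degree one elements, i.e. the restriction to `H` of
`D̃₁ ∘ D̃₂ - D̃₂ ∘ D̃₁`. -/
def brkt11 (g : ℕ) (D₁ D₂ : H g →ₗ[ℚ] T g 2) : H g →ₗ[ℚ] T g 3 :=
  (ext g 1 2 D₁) ∘ₗ D₂ - (ext g 1 2 D₂) ∘ₗ D₁

/-- the contraction `C₁₃ : H^{⊗4} → H^{⊗2}`, `u₁⊗u₂⊗u₃⊗u₄ ↦ (u₁·u₃) u₂⊗u₄`. -/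
def C13 (g : ℕ) (t : T g 4) : T g 2 := fun φ =>
  ∑ a : I g, ∑ b : I g,
    pairH g (Pi.single a 1) (Pi.single b 1) * t ![a, φ 0, b, φ 1]

/-- `D ↦ D(ω₀)` as a linear map. -/
def DomL (g k : ℕ) : (H g →ₗ[ℚ] T g (k+1)) →ₗ[ℚ] T g (k+2) where
  toFun D := Dom g k D
  map_add' D D' := by
    funext φ
    simp only [Dom, LinearMap.add_apply, Pi.add_apply]
    rw [← Finset.sum_add_distrib]
    refine Finset.sum_congr rfl fun i _ => ?_
    ring
  map_smul' a D := by
    funext φ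
    simp only [Dom, LinearMap.smul_apply, Pi.smul_apply, smul_eq_mul, RingHom.id_apply]
    rw [Finset.mul_sum]
    refine Finset.sum_congr rfl fun i _ => ?_
    ring

/-- the degree `k` part `𝔞_g(k)` of the Lie algebra of symplectic derivations. -/
def agS (g k : ℕ) : Submodule ℚ (H g →ₗ[ℚ] T g (k+1)) := LinearMap.ker (DomL g k)

/-- the span of the brackets of two elements of `𝔞_g(1)`. -/
def spanBr (g : ℕ) : Submodule ℚ (H g →ₗ[ℚ] T g 3) :=
  Submodule.span ℚ
    {E | ∃ D₁ D₂ : H g →ₗ[ℚ] T g 2, D₁ ∈ agS g 1 ∧ D₂ ∈ agS g 1 ∧ E = brkt11 g D₁ D₂}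

/-- the wedge product `u ∧ v` as an element of the second exterior power `Λ²H`. -/
noncomputable def wedge (g : ℕ) (u v : H g) : ↥(⋀[ℚ]^2 (H g)) :=
  ⟨ExteriorAlgebra.ιMulti ℚ 2 ![u, v],
    ExteriorAlgebra.ιMulti_range ℚ 2 (Set.mem_range_self _)⟩

/-- the canonical projection `H^{⊗2} → Λ²H`, `u⊗v ↦ u∧v`. -/
noncomputable def proj2 (g : ℕ) (t : T g 2) : ↥(⋀[ℚ]^2 (H g)) :=
  ∑ a : I g, ∑ b : I g,
    t ![a, b] • wedge g (Pi.single a 1) (Pi.single b 1)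

/-- the symplectic class `ω̄₀ = Σᵢ xᵢ ∧ yᵢ ∈ Λ²H`. -/
noncomputable def omBar (g : ℕ) : ↥(⋀[ℚ]^2 (H g)) :=
  ∑ i : Fin g, wedge g (xB g i) (yB g i)

/-- the quotient `Λ²H / ℚ ω̄₀`. -/
abbrev Lambda2Q (g : ℕ) := ↥(⋀[ℚ]^2 (H g)) ⧸ (Submodule.span ℚ {omBar g})

/-- the map `𝔞_g(2) ∋ D ↦ π(C₁₃(D*)) ∈ Λ²H/ℚω̄₀`. -/
noncomputable def piC (g : ℕ) (D : H g →ₗ[ℚ] T g 3) : Lambda2Q g :=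
  Submodule.Quotient.mk (proj2 g (C13 g (dstar g 2 D)))

/-- The sign `ε(a) = a · ā` of a basis vector, where `ā = a.swap` is its symplectic partner. -/
def eps {g : ℕ} : I g → ℚ := Sum.elim (fun _ => 1) (fun _ => -1)

/-- The matrix of the intersection pairing in the symplectic basis. -/
def gram {g : ℕ} (a b : I g) : ℚ := if b = a.swap then eps a else 0

section Signs

variable {g : ℕ}

@[simp] lemma eps_swap (a : I g) : eps a.swap = -eps a := by
  rcases a with i | i <;> simp [eps]

@[simp] lemma eps_mul_self (a : I g) : eps a * eps a = 1 := by
  rcases a with i | i <;> simp [eps]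

lemma eps_ne_zero (a : I g) : eps a ≠ 0 := fun h => by simpa [h] using eps_mul_self a

@[simp] lemma gram_swap (a : I g) : gram a a.swap = eps a := if_pos rfl

lemma gram_eq_zero {a b : I g} (h : b ≠ a.swap) : gram a b = 0 := if_neg h

lemma gram_antisymm (a b : I g) : gram b a = -gram a b := by
  unfold gram
  by_cases h : b = a.swap
  · subst h; simp
  · rw [if_neg h, if_neg, neg_zero]
    rintro rfl
    simp at h

lemma pairH_single (a b : I g) : pairH g (Pi.single a 1) (Pi.single b 1) = gram a b := by
  rcases a with i | i <;> rcases b with j | j <;>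
    simp [pairH, gram, eps, Pi.single_apply, eq_comm, neg_ite]

lemma sum_gram_mul (a : I g) (f : I g → ℚ) : ∑ b, gram a b * f b = eps a * f a.swap := by
  simp [gram]

lemma sum_swap (f : I g → ℚ) : ∑ a : I g, f a.swap = ∑ a, f a :=
  Equiv.sum_comp (Equiv.sumComm (Fin g) (Fin g)) f

lemma sum_eps_swap (f : I g → ℚ) : ∑ a : I g, eps a * f a.swap = -∑ a, eps a * f a := by
  rw [← sum_swap, ← Finset.sum_neg_distrib]
  simp

end Signs

section Star

variable {g : ℕ}

lemma dstar_apply (k : ℕ) (D : H g →ₗ[ℚ] T g (k + 1)) (φ : Fin (k + 2) → I g) :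
    dstar g k D φ = eps (φ 0) * D (Pi.single (φ 0).swap 1) (fun p => φ p.succ) := by
  unfold dstar xB yB
  rcases h : φ 0 with i | i <;> simp [Pi.single_apply, eps]

/-- The map `D ↦ D*` as a linear isomorphism `Hom(H, H^{⊗(k+1)}) ≅ H^{⊗(k+2)}`. -/
def starEquiv (g k : ℕ) : (H g →ₗ[ℚ] T g (k + 1)) ≃ₗ[ℚ] T g (k + 2) where
  toFun := dstar g k
  map_add' D D' := by
    funext φ
    simp [dstar_apply, mul_add]
  map_smul' r D := by
    funext φ
    simp [dstar_apply, mul_left_comm]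
  invFun t :=
    { toFun := fun v ψ => ∑ c, v c * (-eps c * t (Fin.cons c.swap ψ))
      map_add' := fun v w => by
        funext ψ
        simp [-Fintype.sum_sum_type, add_mul, Finset.sum_add_distrib, add_comm]
      map_smul' := fun r v => by
        funext ψ
        simp [-Fintype.sum_sum_type, mul_assoc, Finset.mul_sum] }
  left_inv D := by
    refine LinearMap.pi_ext' fun c => LinearMap.ext_ring ?_
    funext ψ
    simp [-Fintype.sum_sum_type, dstar_apply, Pi.single_apply, ← mul_assoc]
  right_inv t := by
    funext φ
    have h : (Fin.cons (φ 0) fun p : Fin (k + 1) => φ p.succ : Fin (k + 2) → I g) = φ :=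
      Fin.cons_self_tail φ
    simp [-Fintype.sum_sum_type, dstar_apply, Pi.single_apply, ← mul_assoc, h]

lemma starEquiv_apply (k : ℕ) (D : H g →ₗ[ℚ] T g (k + 1)) : starEquiv g k D = dstar g k D := rfl

lemma apply_single (k : ℕ) (D : H g →ₗ[ℚ] T g (k + 1)) (c : I g) (ψ : Fin (k + 1) → I g) :
    D (Pi.single c 1) ψ = -eps c * dstar g k D (Fin.cons c.swap ψ) := by
  simp [dstar_apply, ← mul_assoc]

lemma Dom_apply (k : ℕ) (D : H g →ₗ[ℚ] T g (k + 1)) (φ : Fin (k + 2) → I g) :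
    Dom g k D φ = dstar g k D φ -
      dstar g k D (Fin.cons (φ (Fin.last (k + 1))) fun p => φ p.castSucc) := by
  unfold Dom dstar
  rw [← Finset.sum_sub_distrib]
  refine Finset.sum_congr rfl fun i _ => ?_
  simp only [Fin.cons_zero, Fin.cons_succ]
  ring

lemma mem_agS_iff (k : ℕ) (D : H g →ₗ[ℚ] T g (k + 1)) :
    D ∈ agS g k ↔ ∀ φ, dstar g k D φ =
      dstar g k D (Fin.cons (φ (Fin.last (k + 1))) fun p => φ p.castSucc) := by
  rw [agS, LinearMap.mem_ker, funext_iff]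
  refine forall_congr' fun φ => ?_
  rw [← sub_eq_zero (a := dstar g k D φ), ← Dom_apply]
  rfl

lemma mem_agS_one_iff (D : H g →ₗ[ℚ] T g 2) :
    D ∈ agS g 1 ↔ ∀ a b c, dstar g 1 D ![a, b, c] = dstar g 1 D ![c, a, b] := by
  rw [mem_agS_iff]
  have h (φ : Fin 3 → I g) : φ = ![φ 0, φ 1, φ 2] := by
    funext i; fin_cases i <;> rfl
  have h' (φ : Fin 3 → I g) : (Fin.cons (φ (Fin.last 2)) fun p => φ p.castSucc : Fin 3 → I g) =
      ![φ 2, φ 0, φ 1] := by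
    funext i; fin_cases i <;> rfl
  refine ⟨fun H a b c => (H ![a, b, c]).trans (congrArg _ (h' _)), fun H φ => ?_⟩
  exact (congrArg _ (h φ)).trans ((H _ _ _).trans (congrArg _ (h' φ).symm))

lemma mem_agS_two_iff (D : H g →ₗ[ℚ] T g 3) :
    D ∈ agS g 2 ↔ ∀ a b c d, dstar g 2 D ![a, b, c, d] = dstar g 2 D ![d, a, b, c] := by
  rw [mem_agS_iff]
  have h (φ : Fin 4 → I g) : φ = ![φ 0, φ 1, φ 2, φ 3] := by
    funext i; fin_cases i <;> rfl
  have h' (φ : Fin 4 → I g) : (Fin.cons (φ (Fin.last 3)) fun p => φ p.castSucc : Fin 4 → I g) =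
      ![φ 3, φ 0, φ 1, φ 2] := by
    funext i; fin_cases i <;> rfl
  refine ⟨fun H a b c d => (H ![a, b, c, d]).trans (congrArg _ (h' _)), fun H φ => ?_⟩
  exact (congrArg _ (h φ)).trans ((H _ _ _ _).trans (congrArg _ (h' φ).symm))

lemma C13_apply (t : T g 4) (b d : I g) :
    C13 g t ![b, d] = ∑ a : I g, eps a * t ![a, b, a.swap, d] := by
  simp only [C13, pairH_single, sum_gram_mul]
  rfl

/-- The partial contraction `(s, t) ↦ Σ (p · q) s(p, a, b) t(q, c, d)` of two cubic tensors. -/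
def contr (s t : T g 3) (a b c d : I g) : ℚ :=
  ∑ p : I g, eps p * (s ![p, a, b] * t ![p.swap, c, d])

lemma contr_comm (s t : T g 3) (a b c d : I g) : contr s t a b c d = -contr t s c d a b := by
  unfold contr
  rw [← sum_eps_swap]
  refine Finset.sum_congr rfl fun p _ => ?_
  rw [Sum.swap_swap, mul_comm (s _)]

lemma dstar_brkt11 {D₁ D₂ : H g →ₗ[ℚ] T g 2} (h₁ : D₁ ∈ agS g 1) (h₂ : D₂ ∈ agS g 1)
    (a b c d : I g) :
    dstar g 2 (brkt11 g D₁ D₂) ![a, b, c, d] =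
      contr (dstar g 1 D₁) (dstar g 1 D₂) b c d a + contr (dstar g 1 D₁) (dstar g 1 D₂) c d a b +
      contr (dstar g 1 D₁) (dstar g 1 D₂) d a b c +
      contr (dstar g 1 D₁) (dstar g 1 D₂) a b c d := by
  rw [mem_agS_one_iff] at h₁ h₂
  have key (D E : H g →ₗ[ℚ] T g 2) : eps a * ext g 1 2 D (E (Pi.single a.swap 1)) ![b, c, d] =
      ∑ p : I g, eps p * (dstar g 1 D ![p, b, c] * dstar g 1 E ![a, p.swap, d] +
        dstar g 1 D ![p, c, d] * dstar g 1 E ![a, b, p.swap]) := by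
    have hD (p u v : I g) (ψ : Fin 2 → I g) (h : ψ = ![u, v]) :
        D (Pi.single p.swap 1) ψ = eps p * dstar g 1 D ![p, u, v] := by
      rw [apply_single, eps_swap, neg_neg, Sum.swap_swap, h]
      rfl
    have hE (u v : I g) (ψ : Fin 2 → I g) (h : ψ = ![u, v]) :
        E (Pi.single a.swap 1) ψ = eps a * dstar g 1 E ![a, u, v] := by
      rw [apply_single, eps_swap, neg_neg, Sum.swap_swap, h]
      rfl
    simp only [ext, LinearMap.coe_mk, AddHom.coe_mk, Fin.sum_univ_two]
    rw [← Finset.sum_add_distrib, ← sum_swap, Finset.mul_sum]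
    refine Finset.sum_congr rfl fun p _ => ?_
    rw [hD p b c _ (by funext i; fin_cases i <;> rfl),
      hD p c d _ (by funext i; fin_cases i <;> rfl),
      hE p.swap d _ (by funext i; fin_cases i <;> rfl),
      hE b p.swap _ (by funext i; fin_cases i <;> rfl)]
    linear_combination (eps p * (dstar g 1 D ![p, b, c] * dstar g 1 E ![a, p.swap, d] +
        dstar g 1 D ![p, c, d] * dstar g 1 E ![a, b, p.swap])) * eps_mul_self a
  have hs : dstar g 2 (brkt11 g D₁ D₂) ![a, b, c, d] =
      eps a * ext g 1 2 D₁ (D₂ (Pi.single a.swap 1)) ![b, c, d] -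
        eps a * ext g 1 2 D₂ (D₁ (Pi.single a.swap 1)) ![b, c, d] := by
    rw [dstar_apply, ← mul_sub]
    rfl
  rw [hs, key, key, contr_comm _ _ d a b c, contr_comm _ _ a b c d]
  simp only [contr, mul_add, Finset.sum_add_distrib]
  simp only [h₁ a _ d, h₁ d a, h₁ a b, h₂ a _ d, h₂ d a, h₂ a b]
  ring

end Star

section Brackets

variable {g : ℕ}

lemma brkt11_mem_agS {D₁ D₂ : H g →ₗ[ℚ] T g 2} (h₁ : D₁ ∈ agS g 1) (h₂ : D₂ ∈ agS g 1) :
    brkt11 g D₁ D₂ ∈ agS g 2 := by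
  rw [mem_agS_two_iff]
  intro a b c d
  rw [dstar_brkt11 h₁ h₂, dstar_brkt11 h₁ h₂]
  ring

lemma C13_dstar_brkt11 {D₁ D₂ : H g →ₗ[ℚ] T g 2} (h₁ : D₁ ∈ agS g 1) (h₂ : D₂ ∈ agS g 1) :
    C13 g (dstar g 2 (brkt11 g D₁ D₂)) = 0 := by
  have h₁' := (mem_agS_one_iff D₁).1 h₁
  have h₂' := (mem_agS_one_iff D₂).1 h₂
  have key (D E : H g →ₗ[ℚ] T g 2)
      (hD : ∀ a b c, dstar g 1 D ![a, b, c] = dstar g 1 D ![c, a, b])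
      (hE : ∀ a b c, dstar g 1 E ![a, b, c] = dstar g 1 E ![c, a, b]) (b d : I g) :
      ∑ a : I g, eps a * contr (dstar g 1 D) (dstar g 1 E) b a.swap d a =
        -∑ a : I g, eps a * contr (dstar g 1 D) (dstar g 1 E) a b a.swap d := by
    simp only [contr, Finset.mul_sum]
    rw [Finset.sum_comm, ← Finset.sum_neg_distrib]
    refine Finset.sum_congr rfl fun a _ => ?_
    rw [← sum_swap, ← Finset.sum_neg_distrib]
    refine Finset.sum_congr rfl fun p _ => ?_
    rw [Sum.swap_swap, eps_swap, hD a b p, hE a.swap d p.swap]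
    ring
  funext φ
  have hφ : φ = ![φ 0, φ 1] := by
    funext i; fin_cases i <;> rfl
  rw [hφ, C13_apply]
  simp only [dstar_brkt11 h₁ h₂, mul_add, Finset.sum_add_distrib, Pi.zero_apply]
  have hs (x : I g) := contr_comm (dstar g 1 D₁) (dstar g 1 D₂) x.swap (φ 1) x (φ 0)
  have hs' (x : I g) := contr_comm (dstar g 1 D₁) (dstar g 1 D₂) (φ 1) x (φ 0) x.swap
  simp only [key _ _ h₁' h₂', hs, hs', mul_neg, Finset.sum_neg_distrib, key _ _ h₂' h₁']
  ring

end Brackets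

section Words

variable {g : ℕ}

/-- The matrix entries of the identity. -/
def kron (a b : I g) : ℚ := if a = b then 1 else 0

lemma sum_mul_kron (u : I g) (f : I g → ℚ) : ∑ a, f a * kron a u = f u := by
  simp [-Fintype.sum_sum_type, kron]

lemma kron_swap (a b : I g) : kron a.swap b = kron a b.swap := by
  have : a.swap = b ↔ a = b.swap := ⟨by rintro rfl; simp, by rintro rfl; simp⟩
  simp only [kron, this]

/-- The cyclic symmetrization of the basis tensor `e_u ⊗ e_v ⊗ e_w`. -/
def cycWord₃ (u v w : I g) : T g 3 := fun φ =>
  kron (φ 0) u * kron (φ 1) v * kron (φ 2) w + kron (φ 0) v * kron (φ 1) w * kron (φ 2) u +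
    kron (φ 0) w * kron (φ 1) u * kron (φ 2) v

/-- The basis tensor `e_a ⊗ e_b ⊗ e_c ⊗ e_d`. -/
def word₄ (a b c d : I g) : T g 4 := fun φ =>
  kron (φ 0) a * kron (φ 1) b * kron (φ 2) c * kron (φ 3) d

/-- The cyclic symmetrization of the basis tensor `e_a ⊗ e_b ⊗ e_c ⊗ e_d`. -/
def cycWord₄ (a b c d : I g) : T g 4 :=
  word₄ a b c d + word₄ b c d a + word₄ c d a b + word₄ d a b c

lemma cycWord₄_rotate (a b c d : I g) : cycWord₄ b c d a = cycWord₄ a b c d := by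
  unfold cycWord₄
  abel

lemma symm_cycWord₃_mem (u v w : I g) : (starEquiv g 1).symm (cycWord₃ u v w) ∈ agS g 1 := by
  rw [mem_agS_one_iff]
  intro a b c
  rw [← starEquiv_apply, LinearEquiv.apply_symm_apply]
  simp [cycWord₃]
  ring

lemma contr_cycWord₃ (u₁ u₂ u₃ v₁ v₂ v₃ a b c d : I g) :
    contr (cycWord₃ u₁ u₂ u₃) (cycWord₃ v₁ v₂ v₃) a b c d =
      gram u₁ v₁ * word₄ u₂ u₃ v₂ v₃ ![a, b, c, d] +
      gram u₁ v₂ * word₄ u₂ u₃ v₃ v₁ ![a, b, c, d] +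
      gram u₁ v₃ * word₄ u₂ u₃ v₁ v₂ ![a, b, c, d] +
      gram u₂ v₁ * word₄ u₃ u₁ v₂ v₃ ![a, b, c, d] +
      gram u₂ v₂ * word₄ u₃ u₁ v₃ v₁ ![a, b, c, d] +
      gram u₂ v₃ * word₄ u₃ u₁ v₁ v₂ ![a, b, c, d] +
      gram u₃ v₁ * word₄ u₁ u₂ v₂ v₃ ![a, b, c, d] +
      gram u₃ v₂ * word₄ u₁ u₂ v₃ v₁ ![a, b, c, d] +
      gram u₃ v₃ * word₄ u₁ u₂ v₁ v₂ ![a, b, c, d] := by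
  have h (u v : I g) (x y : ℚ) :
      ∑ p : I g, eps p * (kron p u * x * (kron p.swap v * y)) = gram u v * (x * y) := by
    have e : gram u v = eps u * kron u v.swap := by
      have : v = u.swap ↔ u = v.swap := ⟨by rintro rfl; simp, by rintro rfl; simp⟩
      simp [gram, kron, this]
    rw [e, ← sum_mul_kron u fun p => eps p * kron p v.swap, Finset.sum_mul]
    refine Finset.sum_congr rfl fun p _ => ?_
    rw [kron_swap]
    ring
  simp only [contr, cycWord₃, word₄, Matrix.cons_val, add_mul, mul_add, Finset.sum_add_distrib]
  simp only [mul_assoc (kron _ _) (kron _ _) (kron _ _), h]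
  ring

lemma brkt11_cycWord₃ (u₁ u₂ u₃ v₁ v₂ v₃ : I g) :
    brkt11 g ((starEquiv g 1).symm (cycWord₃ u₁ u₂ u₃)) ((starEquiv g 1).symm (cycWord₃ v₁ v₂ v₃)) =
      (starEquiv g 2).symm (
        gram u₁ v₁ • cycWord₄ u₂ u₃ v₂ v₃ + gram u₁ v₂ • cycWord₄ u₂ u₃ v₃ v₁ +
        gram u₁ v₃ • cycWord₄ u₂ u₃ v₁ v₂ + gram u₂ v₁ • cycWord₄ u₃ u₁ v₂ v₃ +
        gram u₂ v₂ • cycWord₄ u₃ u₁ v₃ v₁ + gram u₂ v₃ • cycWord₄ u₃ u₁ v₁ v₂ +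
        gram u₃ v₁ • cycWord₄ u₁ u₂ v₂ v₃ + gram u₃ v₂ • cycWord₄ u₁ u₂ v₃ v₁ +
        gram u₃ v₃ • cycWord₄ u₁ u₂ v₁ v₂) := by
  rw [LinearEquiv.eq_symm_apply]
  funext φ
  have h : φ = ![φ 0, φ 1, φ 2, φ 3] := by
    funext i; fin_cases i <;> rfl
  rw [h, starEquiv_apply, dstar_brkt11 (symm_cycWord₃_mem _ _ _) (symm_cycWord₃_mem _ _ _)]
  simp only [← starEquiv_apply, LinearEquiv.apply_symm_apply, contr_cycWord₃]
  simp only [cycWord₄, word₄, Pi.add_apply, Pi.smul_apply, smul_eq_mul, Matrix.cons_val]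
  ring

lemma eq_sum_word₄ (t : T g 4) :
    t = ∑ a, ∑ b, ∑ c, ∑ d, t ![a, b, c, d] • word₄ a b c d := by
  funext φ
  have h : φ = ![φ 0, φ 1, φ 2, φ 3] := by
    funext i; fin_cases i <;> rfl
  have hk (u : I g) (f : I g → ℚ) : ∑ a, f a * kron u a = f u := by
    simp [-Fintype.sum_sum_type, kron]
  simp only [Finset.sum_apply, Pi.smul_apply, smul_eq_mul, word₄, ← mul_assoc, hk]
  rw [← h]

end Words

section CyclicFunctions

variable {g : ℕ}

lemma eq_swap_of_gram_ne_zero {a b : I g} (h : gram a b ≠ 0) : b = a.swap := by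
  by_contra hb
  exact h (gram_eq_zero hb)

lemma exists_notMem_of_card_le_six (hg : 4 ≤ g) (s : Finset (I g)) (hs : s.card ≤ 6) :
    ∃ p, p ∉ s := by
  by_contra! h
  have := Finset.card_le_card (fun p _ => h p : Finset.univ ⊆ s)
  simp at this
  omega

/-- The basis vectors `e_p` and `e_a` are neither equal nor symplectic partners. -/
structure Apart (p a : I g) : Prop where
  ne : p ≠ a
  ne_swap : p ≠ a.swap

namespace Apart

variable {p a r : I g}

lemma swap_left (h : Apart p a) : Apart p.swap a :=
  ⟨fun e => h.ne_swap (by simp [← e]), fun e => h.ne (by simpa using congrArg Sum.swap e)⟩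

lemma swap_right (h : Apart p a) : Apart p a.swap := ⟨h.ne_swap, by simpa using h.ne⟩

lemma left (h : Apart p a) : gram p a = 0 := gram_eq_zero fun e => h.ne_swap (by simp [e])

lemma right (h : Apart p a) : gram a p = 0 := gram_eq_zero h.ne_swap

lemma left_swap (h : Apart p a) : gram p.swap a = 0 := h.swap_left.left

lemma right_swap (h : Apart p a) : gram a p.swap = 0 := h.swap_left.right

lemma of_not_apart (h : Apart p a) (h' : ¬ Apart r a) : Apart p r := by
  obtain rfl | rfl : r = a ∨ r = a.swap := by
    by_contra! hr
    exact h' ⟨hr.1, hr.2⟩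
  exacts [h, h.swap_right]

end Apart

lemma exists_apart (hg : 4 ≤ g) (a b c : I g) : ∃ p : I g, Apart p a ∧ Apart p b ∧ Apart p c := by
  obtain ⟨p, hp⟩ := exists_notMem_of_card_le_six hg {a, a.swap, b, b.swap, c, c.swap}
    Finset.card_le_six
  simp only [Finset.mem_insert, Finset.mem_singleton, not_or] at hp
  obtain ⟨h₁, h₂, h₃, h₄, h₅, h₆⟩ := hp
  exact ⟨p, ⟨h₁, h₂⟩, ⟨h₃, h₄⟩, ⟨h₅, h₆⟩⟩

/-- A cyclically invariant function on words of length four which vanishes on the brackets of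
cyclic words of length three. -/
structure KillsBrackets (L : I g → I g → I g → I g → ℚ) : Prop where
  rotate (a b c d : I g) : L b c d a = L a b c d
  bracket (u₁ u₂ u₃ v₁ v₂ v₃ : I g) :
    gram u₁ v₁ * L u₂ u₃ v₂ v₃ + gram u₁ v₂ * L u₂ u₃ v₃ v₁ + gram u₁ v₃ * L u₂ u₃ v₁ v₂ +
    gram u₂ v₁ * L u₃ u₁ v₂ v₃ + gram u₂ v₂ * L u₃ u₁ v₃ v₁ + gram u₂ v₃ * L u₃ u₁ v₁ v₂ +
    gram u₃ v₁ * L u₁ u₂ v₂ v₃ + gram u₃ v₂ * L u₁ u₂ v₃ v₁ + gram u₃ v₃ * L u₁ u₂ v₁ v₂ = 0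

namespace KillsBrackets

variable {L : I g → I g → I g → I g → ℚ}

lemma relation (hL : KillsBrackets L) {a b c d p : I g}
    (ha : gram a p.swap = 0) (hb : gram b p.swap = 0)
    (hc : gram p c = 0) (hd : gram p d = 0) :
    eps p * L a b c d + gram a c * L b p d p.swap + gram a d * L b p p.swap c +
      gram b c * L p a d p.swap + gram b d * L p a p.swap c = 0 := by
  have := hL.bracket p a b p.swap c d
  rw [ha, hb, hc, hd, gram_swap] at this
  linear_combination this

lemma eq_zero_of_split (hL : KillsBrackets L) (hg : 4 ≤ g) {a b c d : I g}
    (hac : gram a c = 0) (had : gram a d = 0)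
    (hbc : gram b c = 0) (hbd : gram b d = 0) : L a b c d = 0 := by
  obtain ⟨p, hp⟩ := exists_notMem_of_card_le_six hg {a, b, c.swap, d.swap}
    (Finset.card_le_four.trans (by norm_num))
  simp only [Finset.mem_insert, Finset.mem_singleton, not_or] at hp
  obtain ⟨ha, hb, hc, hd⟩ := hp
  have := hL.relation (a := a) (b := b) (c := c) (d := d) (p := p)
    (gram_eq_zero fun e => ha (by simpa using congrArg Sum.swap e))
    (gram_eq_zero fun e => hb (by simpa using congrArg Sum.swap e))
    (gram_eq_zero fun e => hc (by simp [e])) (gram_eq_zero fun e => hd (by simp [e]))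
  simpa [hac, had, hbc, hbd, eps_ne_zero] using this

lemma eq_zero_of_opposite (hL : KillsBrackets L) (hg : 4 ≤ g) {a b c d : I g} (hac : gram a c = 0)
    (hbd : gram b d = 0) : L a b c d = 0 := by
  by_cases h : gram a d = 0 ∧ gram b c = 0
  · exact hL.eq_zero_of_split hg hac h.1 h.2 hbd
  obtain ⟨p, ha, hb, hc, hd⟩ : ∃ p, Apart p a ∧ Apart p b ∧ Apart p c ∧ Apart p d := by
    by_cases had : gram a d = 0
    · obtain rfl := eq_swap_of_gram_ne_zero fun hbc => h ⟨had, hbc⟩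
      obtain ⟨p, ha, hb, hd⟩ := exists_apart hg a b d
      exact ⟨p, ha, hb, hb.swap_right, hd⟩
    · obtain rfl := eq_swap_of_gram_ne_zero had
      obtain ⟨p, ha, hb, hc⟩ := exists_apart hg a b c
      exact ⟨p, ha, hb, hc, ha.swap_right⟩
  have h₁ : L b p p.swap c = 0 := by
    rw [← hL.rotate]
    exact hL.eq_zero_of_split hg hc.left hb.left hc.left_swap hb.left_swap
  have h₂ : L p a d p.swap = 0 := by
    rw [← hL.rotate]
    exact hL.eq_zero_of_split hg ha.right_swap ha.right hd.right_swap hd.right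
  simpa [hac, hbd, h₁, h₂, eps_ne_zero] using
    hL.relation ha.right_swap hb.right_swap hc.left hd.left

lemma opposite_relation (hL : KillsBrackets L) (hg : 4 ≤ g) {a b c d p : I g}
    (ha : Apart p a) (hb : Apart p b) (hc : Apart p c) (hd : Apart p d) :
    eps p * L a b c d + gram a c * L b p d p.swap + gram b d * L p a p.swap c = 0 := by
  have h := hL.relation ha.right_swap hb.right_swap hc.left hd.left
  rwa [hL.eq_zero_of_opposite hg hb.right_swap hc.left,
    hL.eq_zero_of_opposite hg hd.left ha.right_swap, mul_zero, mul_zero, add_zero, add_zero] at h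

/-- The normalized value of `L` on `e_a e_q e_c e_q̄` does not depend on `q` if `a · c = 0`. -/
lemma slot_independent (hL : KillsBrackets L) (hg : 4 ≤ g) {a c : I g} (hac : gram a c = 0)
    (q r : I g) :
    eps q * L a q c q.swap = eps r * L a r c r.swap := by
  have step {q p : I g} (ha : Apart p a) (hq : Apart p q) (hc : Apart p c) :
      eps q * L a q c q.swap = eps p * L a p c p.swap := by
    have := hL.opposite_relation hg ha.swap_left hq.swap_left hc.swap_left hq.swap_left.swap_right
    rw [hac, gram_swap, Sum.swap_swap, ← hL.rotate p.swap a p c, eps_swap] at this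
    linear_combination -eps p * eps q * this - eps q * L a q c q.swap * eps_mul_self p +
      eps p * L a p c p.swap * eps_mul_self q
  by_cases h : Apart r a ∧ Apart r q ∧ Apart r c
  · exact step h.1 h.2.1 h.2.2
  obtain ⟨p, ha, hq, hc⟩ := exists_apart hg a q c
  have hr : Apart p r := by
    by_contra hr
    refine h ⟨?_, ?_, ?_⟩ <;> by_contra hr'
    exacts [hr (ha.of_not_apart hr'), hr (hq.of_not_apart hr'), hr (hc.of_not_apart hr')]
  rw [step ha hq hc, step ha hr hc]

/-- `F(a, b) = ε_a ε_b L(e_a e_b e_ā e_b̄)` is a coboundary. -/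
lemma double_eq (hL : KillsBrackets L) (hg : 4 ≤ g) (o a b : I g) :
    L a b a.swap b.swap =
      eps a * (eps o * L o b o.swap b.swap) - eps b * (eps o * L o a o.swap a.swap) := by
  set F : I g → I g → ℚ := fun a b => eps a * eps b * L a b a.swap b.swap with hF
  have hFL (a b : I g) : L a b a.swap b.swap = eps a * eps b * F a b := by
    simp only [hF]
    linear_combination -L a b a.swap b.swap * (eps_mul_self a + eps a * eps a * eps_mul_self b)
  have hsw (a b : I g) : F b a = -F a b.swap := by
    simp only [hF, eps_swap, Sum.swap_swap]
    rw [← hL.rotate]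
    ring
  have hcoc {p a b : I g} (ha : Apart p a) (hb : Apart p b) : F a b + F b p + F p a = 0 := by
    have := hL.opposite_relation hg ha hb ha.swap_right hb.swap_right
    rw [gram_swap, gram_swap] at this
    simp only [hF]
    linear_combination eps a * eps b * eps p * this -
      eps a * eps b * L a b a.swap b.swap * eps_mul_self p -
      eps b * eps p * L b p b.swap p.swap * eps_mul_self a -
      eps p * eps a * L p a p.swap a.swap * eps_mul_self b
  have hdiff {p a b : I g} (ha : Apart p a) (hb : Apart p b) : F a b = F a p - F b p := by
    have h₁ := hcoc (p := p) (a := b.swap) (b := a) hb.swap_right ha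
    rw [hsw a b.swap, Sum.swap_swap] at h₁
    linear_combination -h₁ + hsw p b
  obtain ⟨p, ha, hb, ho⟩ := exists_apart hg a b o
  rw [hFL a b, hFL o b, hFL o a, hdiff ha hb, hdiff ho hb, hdiff ho ha]
  linear_combination (- eps a * eps b * (F a p - F b p)) * eps_mul_self o

lemma eq_contraction (hL : KillsBrackets L) (hg : 4 ≤ g) (o a b c d : I g) :
    L a b c d = gram a c * (eps o * L o b o.swap d) - gram b d * (eps o * L o a o.swap c) := by
  have key {a c : I g} (hac : gram a c = 0) (b : I g) :
      L a b c b.swap = - eps b * (eps o * L o a o.swap c) := by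
    have h := hL.slot_independent hg hac b o.swap
    rw [Sum.swap_swap, hL.rotate o a, eps_swap] at h
    linear_combination eps b * h - L a b c b.swap * eps_mul_self b
  by_cases hac : gram a c = 0 <;> by_cases hbd : gram b d = 0
  · rw [hac, hbd, hL.eq_zero_of_opposite hg hac hbd]
    ring
  · obtain rfl := eq_swap_of_gram_ne_zero hbd
    rw [hac, key hac, gram_swap]
    ring
  · obtain rfl := eq_swap_of_gram_ne_zero hac
    rw [← hL.rotate, hbd, gram_swap]
    have := key hbd a.swap
    rw [Sum.swap_swap, eps_swap] at this
    rw [this]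
    ring
  · obtain rfl := eq_swap_of_gram_ne_zero hac
    obtain rfl := eq_swap_of_gram_ne_zero hbd
    rw [gram_swap, gram_swap]
    exact hL.double_eq hg o a b

end KillsBrackets

end CyclicFunctions

section Kernel

variable {g : ℕ}

lemma sum_rotate {M : Type*} [AddCommMonoid M] (F : I g → I g → I g → I g → M) :
    ∑ a, ∑ b, ∑ c, ∑ d, F b c d a = ∑ a, ∑ b, ∑ c, ∑ d, F a b c d := by
  rw [Finset.sum_comm]
  refine Finset.sum_congr rfl fun b _ => ?_
  rw [Finset.sum_comm]
  refine Finset.sum_congr rfl fun c _ => ?_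
  rw [Finset.sum_comm]

lemma sum_mul_gram_mul (t : T g 4) (M : I g → I g → ℚ) :
    ∑ a, ∑ b, ∑ c, ∑ d, t ![a, b, c, d] * (gram a c * M b d) =
      ∑ b, ∑ d, C13 g t ![b, d] * M b d := by
  rw [Finset.sum_comm]
  refine Finset.sum_congr rfl fun b _ => ?_
  rw [Finset.sum_congr rfl fun a _ => Finset.sum_comm, Finset.sum_comm]
  refine Finset.sum_congr rfl fun d _ => ?_
  rw [C13_apply, Finset.sum_mul]
  refine Finset.sum_congr rfl fun a _ => ?_
  rw [mul_assoc, ← sum_gram_mul a fun c => t ![a, b, c, d] * M b d]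
  exact Finset.sum_congr rfl fun c _ => mul_left_comm _ _ _

lemma cyclic_eq_sum_cycWord₄ {t : T g 4}
    (ht : ∀ a b c d, t ![a, b, c, d] = t ![d, a, b, c]) :
    (4 : ℚ) • t = ∑ a, ∑ b, ∑ c, ∑ d, t ![a, b, c, d] • cycWord₄ a b c d := by
  let F (a b c d : I g) : T g 4 := t ![a, b, c, d] • word₄ a b c d
  have hF (a b c d : I g) :
      t ![a, b, c, d] • cycWord₄ a b c d = F a b c d + F b c d a + F c d a b + F d a b c := by
    simp only [F, cycWord₄, smul_add]
    rw [ht d a b c, ht c d a b, ht b c d a]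
  simp only [hF, Finset.sum_add_distrib]
  have h₁ : ∑ a, ∑ b, ∑ c, ∑ d, F b c d a = ∑ a, ∑ b, ∑ c, ∑ d, F a b c d := sum_rotate F
  have h₂ : ∑ a, ∑ b, ∑ c, ∑ d, F c d a b = ∑ a, ∑ b, ∑ c, ∑ d, F b c d a :=
    sum_rotate fun a b c d => F b c d a
  have h₃ : ∑ a, ∑ b, ∑ c, ∑ d, F d a b c = ∑ a, ∑ b, ∑ c, ∑ d, F c d a b :=
    sum_rotate fun a b c d => F c d a b
  rw [h₃, h₂, h₁, ← eq_sum_word₄ t]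
  module

lemma C13_antisymm {t : T g 4} (ht : ∀ a b c d, t ![a, b, c, d] = t ![d, a, b, c]) (b d : I g) :
    C13 g t ![d, b] = -C13 g t ![b, d] := by
  rw [C13_apply, C13_apply, ← sum_eps_swap]
  refine Finset.sum_congr rfl fun a _ => ?_
  rw [Sum.swap_swap, ht a d, ht b a]

lemma sum_eps_mul_C13 {t : T g 4} (ht : ∀ a b c d, t ![a, b, c, d] = t ![d, a, b, c]) :
    ∑ a : I g, eps a * C13 g t ![a, a.swap] = 0 := by
  have h : ∑ a : I g, eps a * C13 g t ![a, a.swap] =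
      -∑ a : I g, eps a * C13 g t ![a, a.swap] := by
    simp only [C13_apply, Finset.mul_sum]
    conv_lhs => rw [Finset.sum_comm]
    rw [← Finset.sum_neg_distrib]
    refine Finset.sum_congr rfl fun p _ => ?_
    rw [← sum_swap, ← Finset.sum_neg_distrib]
    refine Finset.sum_congr rfl fun q _ => ?_
    rw [Sum.swap_swap, eps_swap, ht p]
    ring
  linarith

/-- A cyclically invariant tensor with vanishing contraction lies in the span of the brackets. -/
lemma mem_spanBr_of_C13_eq_zero (hg : 4 ≤ g) {D : H g →ₗ[ℚ] T g 3} (hD : D ∈ agS g 2)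
    (hC : C13 g (dstar g 2 D) = 0) : D ∈ spanBr g := by
  by_contra hmem
  obtain ⟨l, hl, hker⟩ := Submodule.exists_le_ker_of_notMem hmem
  rw [mem_agS_two_iff] at hD
  set t := dstar g 2 D with ht
  let L : I g → I g → I g → I g → ℚ := fun a b c d => l ((starEquiv g 2).symm (cycWord₄ a b c d))
  have hL : KillsBrackets L := by
    refine ⟨fun a b c d => by simp only [L, cycWord₄_rotate], fun u₁ u₂ u₃ v₁ v₂ v₃ => ?_⟩
    have := hker (Submodule.subset_span ⟨_, _, symm_cycWord₃_mem u₁ u₂ u₃,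
      symm_cycWord₃_mem v₁ v₂ v₃, rfl⟩)
    rw [LinearMap.mem_ker, brkt11_cycWord₃] at this
    simpa only [map_add, map_smul, smul_eq_mul] using this
  have hlD : 4 * l D = ∑ a, ∑ b, ∑ c, ∑ d, t ![a, b, c, d] * L a b c d := by
    have hD' : (4 : ℚ) • D = (starEquiv g 2).symm ((4 : ℚ) • t) := by
      rw [LinearEquiv.eq_symm_apply, map_smul, starEquiv_apply]
    rw [← smul_eq_mul, ← map_smul, hD', cyclic_eq_sum_cycWord₄ hD]
    simp only [map_sum, map_smul, smul_eq_mul, L]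
  let o : I g := Sum.inl ⟨0, by omega⟩
  let M (b d : I g) : ℚ := eps o * L o b o.swap d
  have hexp : 4 * l D = ∑ a, ∑ b, ∑ c, ∑ d, t ![a, b, c, d] * (gram a c * M b d) -
      ∑ a, ∑ b, ∑ c, ∑ d, t ![a, b, c, d] * (gram b d * M a c) := by
    rw [hlD]
    simp only [← Finset.sum_sub_distrib, ← mul_sub]
    refine Finset.sum_congr rfl fun a _ => Finset.sum_congr rfl fun b _ =>
      Finset.sum_congr rfl fun c _ => Finset.sum_congr rfl fun d _ => ?_
    exact congrArg _ (hL.eq_contraction hg o a b c d)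
  have hrot : ∑ a, ∑ b, ∑ c, ∑ d, t ![a, b, c, d] * (gram b d * M a c) =
      ∑ a, ∑ b, ∑ c, ∑ d, t ![a, b, c, d] * (gram a c * M d b) := by
    refine Eq.trans ?_ (sum_rotate fun a b c d => t ![a, b, c, d] * (gram a c * M d b))
    refine Finset.sum_congr rfl fun a _ => Finset.sum_congr rfl fun b _ =>
      Finset.sum_congr rfl fun c _ => Finset.sum_congr rfl fun d _ => ?_
    rw [hD b c d a]
  rw [hrot, sum_mul_gram_mul, sum_mul_gram_mul t fun b d => M d b, hC] at hexp
  simp only [Pi.zero_apply, zero_mul, Finset.sum_const_zero, sub_zero] at hexp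
  exact hl (by linarith)

end Kernel

section ExteriorSquare

variable {g : ℕ}

lemma wedge_eq_ιMulti (u v : H g) : wedge g u v = exteriorPower.ιMulti ℚ 2 ![u, v] := rfl

/-- The linear functional on `Λ²H` dual to `e_a ∧ e_b`. -/
noncomputable def wedgeCoord (a b : I g) : ↥(⋀[ℚ]^2 (H g)) →ₗ[ℚ] ℚ :=
  exteriorPower.pairingDual ℚ (H g) 2
    (exteriorPower.ιMulti ℚ 2 ![LinearMap.proj a, LinearMap.proj b])

lemma wedgeCoord_wedge (a b : I g) (u v : H g) :
    wedgeCoord a b (wedge g u v) = u a * v b - u b * v a := by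
  rw [wedgeCoord, wedge_eq_ιMulti, exteriorPower.pairingDual_ιMulti_ιMulti, Matrix.det_fin_two]
  simp

lemma wedge_swap (u v : H g) : wedge g v u = -wedge g u v := by
  rw [wedge_eq_ιMulti, wedge_eq_ιMulti,
    ← (exteriorPower.ιMulti ℚ 2).map_swap ![u, v] (i := 0) (j := 1) (by decide)]
  congr 1
  funext i
  fin_cases i <;> rfl

/-- The projection `H^{⊗2} → Λ²H` as a linear map. -/
noncomputable def proj2L (g : ℕ) : T g 2 →ₗ[ℚ] ↥(⋀[ℚ]^2 (H g)) where
  toFun := proj2 g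
  map_add' s t := by
    simp [-Fintype.sum_sum_type, proj2, add_smul, Finset.sum_add_distrib]
  map_smul' r t := by
    simp [-Fintype.sum_sum_type, proj2, mul_smul, Finset.smul_sum]

lemma proj2L_apply (t : T g 2) : proj2L g t = proj2 g t := rfl

lemma wedgeCoord_proj2 (t : T g 2) (a b : I g) :
    wedgeCoord a b (proj2 g t) = t ![a, b] - t ![b, a] := by
  simp only [proj2, map_sum, map_smul, wedgeCoord_wedge, smul_eq_mul, mul_sub,
    Finset.sum_sub_distrib, Pi.single_apply]
  simp [-Fintype.sum_sum_type]

lemma wedgeCoord_omBar (a b : I g) : wedgeCoord a b (omBar g) = gram a b := by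
  simp only [omBar, map_sum, wedgeCoord_wedge, xB, yB]
  rw [← pairH_single]
  simp only [pairH, Pi.single_apply, eq_comm]
  exact Finset.sum_congr rfl fun i _ => by ring

lemma proj2_swap (t : T g 2) : proj2 g (fun φ => t ![φ 1, φ 0]) = -proj2 g t := by
  unfold proj2
  rw [Finset.sum_comm, ← Finset.sum_neg_distrib]
  refine Finset.sum_congr rfl fun a _ => ?_
  rw [← Finset.sum_neg_distrib]
  refine Finset.sum_congr rfl fun b _ => ?_
  rw [wedge_swap, smul_neg]
  rfl

lemma proj2_gram : proj2 g (fun φ => gram (φ 0) (φ 1)) = (2 : ℚ) • omBar g := by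
  have h (a : I g) : ∑ b, gram a b • wedge g (Pi.single a 1) (Pi.single b 1) =
      eps a • wedge g (Pi.single a 1) (Pi.single a.swap 1) := by
    simp [-Fintype.sum_sum_type, gram]
  simp only [proj2, Matrix.cons_val, h, Fintype.sum_sum_type, omBar, xB, yB]
  simp [eps, wedge_swap (Pi.single (Sum.inl _) 1) (Pi.single (Sum.inr _) 1), two_smul]

lemma proj2_surjective : Function.Surjective (proj2 g) := by
  change Function.Surjective (proj2L g)
  rw [← LinearMap.range_eq_top, eq_top_iff, ← exteriorPower.ιMulti_span, Submodule.span_le]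
  rintro _ ⟨v, rfl⟩
  refine ⟨fun φ => v 0 (φ 0) * v 1 (φ 1), ?_⟩
  have hv : v = fun i => ∑ a, v i a • (Pi.single a 1 : H g) := by
    funext i
    exact pi_eq_sum_univ' (v i)
  have hm := (exteriorPower.ιMulti ℚ 2 (M := H g)).toMultilinearMap.map_sum
    fun (i : Fin 2) (a : I g) => v i a • (Pi.single a 1 : H g)
  rw [← hv] at hm
  refine Eq.trans ?_ hm.symm
  rw [proj2L_apply, proj2, ← (finTwoArrowEquiv (I g)).symm.sum_comp, Fintype.sum_prod_type]
  refine Finset.sum_congr rfl fun a _ => Finset.sum_congr rfl fun b _ => ?_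
  rw [MultilinearMap.map_smul_univ, Fin.prod_univ_two, wedge_eq_ιMulti]
  refine congrArg (_ • exteriorPower.ιMulti ℚ 2 ·) ?_
  funext i
  fin_cases i <;> rfl

end ExteriorSquare

section Main

variable {g : ℕ}

/-- The contraction `C₁₃` as a linear map. -/
def C13L (g : ℕ) : T g 4 →ₗ[ℚ] T g 2 where
  toFun := C13 g
  map_add' s t := by
    funext φ
    simp only [C13, Pi.add_apply, mul_add, Finset.sum_add_distrib]
  map_smul' r t := by
    funext φ
    simp only [C13, Pi.smul_apply, smul_eq_mul, RingHom.id_apply, Finset.mul_sum, mul_left_comm]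

/-- The map `D ↦ π(C₁₃(D*))` as a linear map on `Hom(H, H^{⊗3})`. -/
noncomputable def piCL (g : ℕ) : (H g →ₗ[ℚ] T g 3) →ₗ[ℚ] Lambda2Q g :=
  Submodule.mkQ _ ∘ₗ proj2L g ∘ₗ C13L g ∘ₗ (starEquiv g 2).toLinearMap

lemma C13_eq_zero_of_piC_eq_zero (hg : g ≠ 0) {D : H g →ₗ[ℚ] T g 3} (hD : D ∈ agS g 2)
    (h : piC g D = 0) : C13 g (dstar g 2 D) = 0 := by
  rw [mem_agS_two_iff] at hD
  rw [piC, Submodule.Quotient.mk_eq_zero, Submodule.mem_span_singleton] at h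
  obtain ⟨r, hr⟩ := h
  have hK (a b : I g) : r * gram a b = 2 * C13 g (dstar g 2 D) ![a, b] := by
    rw [← wedgeCoord_omBar, ← smul_eq_mul, ← map_smul, hr, wedgeCoord_proj2, C13_antisymm hD a b]
    ring
  have hr0 : r = 0 := by
    have h := sum_eps_mul_C13 hD
    have h' (a : I g) : eps a * C13 g (dstar g 2 D) ![a, a.swap] = r / 2 := by
      have := hK a a.swap
      rw [gram_swap] at this
      linear_combination -eps a * this / 2 + r / 2 * eps_mul_self a
    simpa [h', hg] using h
  funext φ
  have hφ : φ = ![φ 0, φ 1] := by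
    funext i
    fin_cases i <;> rfl
  have := hK (φ 0) (φ 1)
  rw [hr0, ← hφ] at this
  simpa using this

lemma exists_mem_agS_piC_eq (hg : 4 ≤ g) (z : Lambda2Q g) : ∃ D ∈ agS g 2, piC g D = z := by
  obtain ⟨w, rfl⟩ := Submodule.Quotient.mk_surjective _ z
  obtain ⟨s, rfl⟩ := proj2_surjective w
  have hg0 : (g : ℚ) ≠ 0 := by positivity
  let M (a b : I g) : ℚ := (s ![a, b] - s ![b, a]) / (4 * g)
  have hM (a b : I g) : M b a = -M a b := by
    simp only [M]
    ring
  let t : T g 4 := fun φ => gram (φ 0) (φ 2) * M (φ 1) (φ 3) - gram (φ 1) (φ 3) * M (φ 0) (φ 2)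
  have ht : dstar g 2 ((starEquiv g 2).symm t) = t := by
    rw [← starEquiv_apply, LinearEquiv.apply_symm_apply]
  refine ⟨(starEquiv g 2).symm t, ?_, ?_⟩
  · rw [mem_agS_two_iff, ht]
    intro a b c d
    simp only [t, Matrix.cons_val]
    rw [gram_antisymm b d, hM b d]
    ring
  · have hC : C13 g t = (1 / 2 : ℚ) • (s - fun φ => s ![φ 1, φ 0]) -
        (∑ a : I g, eps a * M a a.swap) • fun φ => gram (φ 0) (φ 1) := by
      funext φ
      have hφ : φ = ![φ 0, φ 1] := by
        funext i
        fin_cases i <;> rfl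
      have hsum : C13 g t ![φ 0, φ 1] = ∑ a : I g, M (φ 0) (φ 1) -
          gram (φ 0) (φ 1) * ∑ a : I g, eps a * M a a.swap := by
        rw [C13_apply, Finset.mul_sum, ← Finset.sum_sub_distrib]
        refine Finset.sum_congr rfl fun a _ => ?_
        simp only [t, Matrix.cons_val, gram_swap]
        linear_combination M (φ 0) (φ 1) * eps_mul_self a
      have hcard : ∑ a : I g, M (φ 0) (φ 1) = (s ![φ 0, φ 1] - s ![φ 1, φ 0]) / 2 := by
        rw [Finset.sum_const, Finset.card_univ, Fintype.card_sum, Fintype.card_fin, nsmul_eq_mul]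
        simp only [M]
        push_cast
        field_simp
        ring
      simp only [Pi.sub_apply, Pi.smul_apply, smul_eq_mul]
      rw [show C13 g t φ = C13 g t ![φ 0, φ 1] from congrArg _ hφ,
        show s φ = s ![φ 0, φ 1] from congrArg _ hφ, hsum, hcard]
      ring
    rw [piC, ht, Submodule.Quotient.eq, Submodule.mem_span_singleton]
    refine ⟨-(2 * ∑ a : I g, eps a * M a a.swap), ?_⟩
    rw [← proj2L_apply, hC]
    simp only [map_sub, map_smul, proj2L_apply, proj2_swap, proj2_gram]
    module

end Main

/-- for `g ≥ 4`, the map `𝔞_g(2) → Λ²H/ℚω̄₀`, `D ↦ π(C₁₃(D*))`, is surjective,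
its kernel is exactly the span of the brackets `[D₁,D₂]`, `D₁, D₂ ∈ 𝔞_g(1)`; consequently it
induces a linear isomorphism `H₁(𝔞_g⁺)₂ = 𝔞_g(2)/(span of brackets) ≅ Λ²H/ℚω̄₀`. -/
theorem stmt9 (g : ℕ) (hg : 4 ≤ g) :
    (∀ z : Lambda2Q g, ∃ D ∈ agS g 2, piC g D = z) ∧
    {D : H g →ₗ[ℚ] T g 3 | D ∈ agS g 2 ∧ piC g D = 0} = (spanBr g : Set _) ∧
    ∃ e : (↥(agS g 2) ⧸ (Submodule.comap (agS g 2).subtype (spanBr g))) ≃ₗ[ℚ] Lambda2Q g,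
      ∀ D : ↥(agS g 2), e (Submodule.Quotient.mk D) = piC g D.1 := by
  have hspan : spanBr g ≤ agS g 2 ⊓ LinearMap.ker (piCL g) := by
    refine Submodule.span_le.2 ?_
    rintro _ ⟨D₁, D₂, h₁, h₂, rfl⟩
    refine ⟨brkt11_mem_agS h₁ h₂, ?_⟩
    change piC g _ = 0
    rw [piC, C13_dstar_brkt11 h₁ h₂, Submodule.Quotient.mk_eq_zero]
    simp [proj2]
  have hker (D : H g →ₗ[ℚ] T g 3) : D ∈ spanBr g ↔ D ∈ agS g 2 ∧ piC g D = 0 :=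
    ⟨fun h => hspan h,
      fun h => mem_spanBr_of_C13_eq_zero hg h.1 (C13_eq_zero_of_piC_eq_zero (by lia) h.1 h.2)⟩
  refine ⟨exists_mem_agS_piC_eq hg, Set.ext fun D => (hker D).symm, ?_⟩
  let f : ↥(agS g 2) →ₗ[ℚ] Lambda2Q g := piCL g ∘ₗ (agS g 2).subtype
  have hf : Function.Surjective f := fun z => by
    obtain ⟨D, hD, hz⟩ := exists_mem_agS_piC_eq hg z
    exact ⟨⟨D, hD⟩, hz⟩
  have hfker : Submodule.comap (agS g 2).subtype (spanBr g) = LinearMap.ker f := by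
    ext D
    exact (hker D.1).trans (and_iff_right D.2)
  exact ⟨(Submodule.quotEquivOfEq _ _ hfker).trans (f.quotKerEquivOfSurjective hf),
    fun D => rfl⟩
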